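/- arXiv:2005.05890 — 5 statements merged into one kernel-verified Lean document; each statement's English description precedes it below -/
import Mathlib

section
/- Let N, n, p be positive natural numbers with n ≤ N, let A ∈ ℝ^{N×N}, B ∈ ℝ^{N×p}, and let V ∈ ℝ^{N×n} have orthonormal columns (VᵀV = Iₙ). Then there exist trajectory lengths K₁,…,K_{n+p} ≥ 1, input trajectories g₁^{(ℓ)},…,g_{K_ℓ}^{(ℓ)} ∈ ℝ^p, and initial conditions w₀^{(1)},…,w₀^{(n+p)} lying in the column space of V such that the generalized data matrix Φ ∈ ℝ^{(Σ_ℓ K_ℓ)×(n+p)}, whose rows are the concatenated vectors [(w̄_k^{(ℓ)})ᵀ (g_{k+1}^{(ℓ)})ᵀ] for ℓ = 1,…,n+p and k = 0,…,K_ℓ−1, has full column rank n+p. Here w̄^{(ℓ)} denotes the re-projected trajectory of the ℓ-th experiment. -/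
open Matrix

/-- Squared-sum Euclidean 2-norm on `Fin N → ℝ`. -/
noncomputable def e2norm {N : ℕ} (v : Fin N → ℝ) : ℝ :=
  ‖(WithLp.equiv 2 (Fin N → ℝ)).symm v‖

/-- There exist trajectory lengths, input trajectories, and initial conditions in the
column space of `V` such that the generalized data matrix (rows = concatenated
re-projected states and inputs) has full column rank `n + p`. -/
theorem exists_full_rank_data_matrix
    (N n p : ℕ) (hN : 0 < N) (hn : 0 < n) (hp : 0 < p) (hnN : n ≤ N)
    (A : Matrix (Fin N) (Fin N) ℝ) (B : Matrix (Fin N) (Fin p) ℝ)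
    (V : Matrix (Fin N) (Fin n) ℝ) (hV : Vᵀ * V = 1) :
    ∃ (K : Fin (n + p) → ℕ) (g : Fin (n + p) → ℕ → Fin p → ℝ)
      (w0 : Fin (n + p) → Fin N → ℝ) (wbar : Fin (n + p) → ℕ → Fin n → ℝ),
      (∀ ℓ, 1 ≤ K ℓ) ∧
      (∀ ℓ, ∃ c : Fin n → ℝ, w0 ℓ = V.mulVec c) ∧
      (∀ ℓ, wbar ℓ 0 = Vᵀ.mulVec (w0 ℓ)) ∧
      (∀ ℓ k, wbar ℓ (k + 1) =
        Vᵀ.mulVec (A.mulVec (V.mulVec (wbar ℓ k)) + B.mulVec (g ℓ (k + 1)))) ∧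
      (Matrix.of fun (row : Σ ℓ : Fin (n + p), Fin (K ℓ)) (j : Fin n ⊕ Fin p) =>
          Sum.elim (fun i => wbar row.1 (row.2 : ℕ) i)
            (fun i => g row.1 ((row.2 : ℕ) + 1) i) j).rank = n + p := by
  let e : (Σ _ : Fin (n + p), Fin 1) ≃ Fin n ⊕ Fin p :=
    (Equiv.sigmaUnique _ _).trans finSumFinEquiv.symm
  let x (ℓ : Fin (n + p)) : Fin n ⊕ Fin p → ℝ :=
    (1 : Matrix (Fin n ⊕ Fin p) (Fin n ⊕ Fin p) ℝ) (finSumFinEquiv.symm ℓ)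
  let u (ℓ : Fin (n + p)) : Fin p → ℝ := fun i => x ℓ (Sum.inr i)
  let c (ℓ : Fin (n + p)) : Fin n → ℝ := fun i => x ℓ (Sum.inl i)
  refine ⟨fun _ => 1, fun ℓ _ => u ℓ, fun ℓ => V *ᵥ c ℓ,
    fun ℓ k => Nat.rec (c ℓ) (fun _ w => Vᵀ *ᵥ (A *ᵥ (V *ᵥ w) + B *ᵥ u ℓ)) k,
    fun _ => le_rfl, fun ℓ => ⟨c ℓ, rfl⟩, fun ℓ => ?_, fun _ _ => rfl, ?_⟩
  · simp [Matrix.mulVec_mulVec, hV]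
  · have rank_one_submatrix := Matrix.rank_submatrix
      (1 : Matrix (Fin n ⊕ Fin p) (Fin n ⊕ Fin p) ℝ) e (Equiv.refl _)
    rw [Matrix.rank_one, Fintype.card_sum, Fintype.card_fin, Fintype.card_fin]
      at rank_one_submatrix
    refine Eq.trans (congrArg Matrix.rank ?_) rank_one_submatrix
    ext ⟨ℓ, k⟩ j
    obtain rfl : k = 0 := Subsingleton.elim _ _
    cases j <;> rfl
end

section
/- Let A ∈ ℝ^{N×N}, B ∈ ℝ^{N×p}, V ∈ ℝ^{N×n}, and define M₁ = VᵀAᵀAV, M₂ = BᵀB, M₃ = BᵀAV, M₄ = VᵀV, Ã = VᵀAV, B̃ = VᵀB. Let w̄₀,…,w̄_K ∈ ℝ^n and g₁,…,g_K ∈ ℝ^p be given, and for k = 0,…,K−1 set r̄_k = A V w̄_k + B g_{k+1} − V w̄_{k+1} and f_{k+1} = ‖r̄_k‖₂² − w̄_{k+1}ᵀM₄w̄_{k+1} + 2 w̄_{k+1}ᵀÃ w̄_k + 2 w̄_{k+1}ᵀB̃ g_{k+1}. Consider minimizing J(M̂₁, M̂₂, M̂₃) = Σ_{k=0}^{K−1}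 ( w̄_kᵀM̂₁w̄_k + g_{k+1}ᵀM̂₂g_{k+1} + 2 g_{k+1}ᵀM̂₃w̄_k − f_{k+1} )² over symmetric M̂₁ ∈ ℝ^{n×n}, symmetric M̂₂ ∈ ℝ^{p×p}, and M̂₃ ∈ ℝ^{p×n}. Assume the linear map sending a triple (S₁, S₂, S₃), with S₁ ∈ ℝ^{n×n} symmetric, S₂ ∈ ℝ^{p×p} symmetric, S₃ ∈ ℝ^{p×n}, to the vector ( w̄_kᵀS₁w̄_k + g_{k+1}ᵀS₂g_{k+1} + 2 g_{k+1}ᵀS₃w̄_k )_{k=0}^{K−1} ∈ ℝ^K is injective. Then (M₁, M₂, M₃) is the unique minimizer, and the minimum objective value is 0. -/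
open Matrix

theorem e2norm_sq {N : ℕ} (v : Fin N → ℝ) : e2norm v ^ 2 = v ⬝ᵥ v := by
  rw [e2norm, EuclideanSpace.real_norm_sq_eq]
  simp [dotProduct, sq]

theorem dotProduct_transpose_mul_mulVec {l m n R : Type*} [Fintype l] [Fintype m] [Fintype n]
    [CommSemiring R] (P : Matrix l m R) (Q : Matrix l n R) (u : m → R) (v : n → R) :
    u ⬝ᵥ (Pᵀ * Q).mulVec v = P.mulVec u ⬝ᵥ Q.mulVec v := by
  rw [← mulVec_mulVec, dotProduct_mulVec, vecMul_transpose]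

/-- The quadratic form of the residual operators reproduces the squared residual norm with the
terms involving the next state removed. -/
theorem residual_quadratic_form_eq {N n p : ℕ}
    (A : Matrix (Fin N) (Fin N) ℝ) (B : Matrix (Fin N) (Fin p) ℝ)
    (V : Matrix (Fin N) (Fin n) ℝ) (w w' : Fin n → ℝ) (u : Fin p → ℝ) :
    w ⬝ᵥ (Vᵀ * Aᵀ * A * V).mulVec w + u ⬝ᵥ (Bᵀ * B).mulVec u
        + 2 * (u ⬝ᵥ (Bᵀ * A * V).mulVec w) =
      e2norm (A.mulVec (V.mulVec w) + B.mulVec u - V.mulVec w') ^ 2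
        - w' ⬝ᵥ (Vᵀ * V).mulVec w' + 2 * (w' ⬝ᵥ (Vᵀ * A * V).mulVec w)
        + 2 * (w' ⬝ᵥ (Vᵀ * B).mulVec u) := by
  have hV : Vᵀ * Aᵀ * A * V = (A * V)ᵀ * (A * V) := by
    rw [transpose_mul, Matrix.mul_assoc (Vᵀ * Aᵀ)]
  rw [hV, Matrix.mul_assoc Bᵀ, Matrix.mul_assoc Vᵀ, e2norm_sq]
  simp only [dotProduct_transpose_mul_mulVec, add_dotProduct, dotProduct_add,
    sub_dotProduct, dotProduct_sub]
  simp only [← mulVec_mulVec]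
  rw [dotProduct_comm (B.mulVec u) (A.mulVec (V.mulVec w)),
    dotProduct_comm (V.mulVec w') (A.mulVec (V.mulVec w)),
    dotProduct_comm (V.mulVec w') (B.mulVec u)]
  ring

/-- If the linear map sending a triple `(S₁, S₂, S₃)` (with `S₁`, `S₂` symmetric) to the
vector of quadratic-form evaluations on the data is injective, then
`(M₁, M₂, M₃) = (VᵀAᵀAV, BᵀB, BᵀAV)` is the unique minimizer of the residual-norm
least-squares objective over triples of that shape, with minimum value `0`. -/
theorem residual_operators_unique_minimizer
    (N n p K : ℕ)
    (A : Matrix (Fin N) (Fin N) ℝ) (B : Matrix (Fin N) (Fin p) ℝ)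
    (V : Matrix (Fin N) (Fin n) ℝ)
    (wbar : ℕ → Fin n → ℝ) (g : ℕ → Fin p → ℝ) (f : ℕ → ℝ)
    (hf : ∀ k < K, f (k + 1) =
      (e2norm (A.mulVec (V.mulVec (wbar k)) + B.mulVec (g (k + 1))
          - V.mulVec (wbar (k + 1)))) ^ 2
      - wbar (k + 1) ⬝ᵥ (Vᵀ * V).mulVec (wbar (k + 1))
      + 2 * (wbar (k + 1) ⬝ᵥ (Vᵀ * A * V).mulVec (wbar k))
      + 2 * (wbar (k + 1) ⬝ᵥ (Vᵀ * B).mulVec (g (k + 1))))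
    (hinj : ∀ (S1 : Matrix (Fin n) (Fin n) ℝ) (S2 : Matrix (Fin p) (Fin p) ℝ)
        (S3 : Matrix (Fin p) (Fin n) ℝ), S1.IsSymm → S2.IsSymm →
        (∀ k < K, wbar k ⬝ᵥ S1.mulVec (wbar k) + g (k + 1) ⬝ᵥ S2.mulVec (g (k + 1))
          + 2 * (g (k + 1) ⬝ᵥ S3.mulVec (wbar k)) = 0) →
        S1 = 0 ∧ S2 = 0 ∧ S3 = 0) :
    (∑ k ∈ Finset.range K,
        (wbar k ⬝ᵥ (Vᵀ * Aᵀ * A * V).mulVec (wbar k)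
          + g (k + 1) ⬝ᵥ (Bᵀ * B).mulVec (g (k + 1))
          + 2 * (g (k + 1) ⬝ᵥ (Bᵀ * A * V).mulVec (wbar k)) - f (k + 1)) ^ 2 = 0) ∧
    ∀ (M1 : Matrix (Fin n) (Fin n) ℝ) (M2 : Matrix (Fin p) (Fin p) ℝ)
      (M3 : Matrix (Fin p) (Fin n) ℝ), M1.IsSymm → M2.IsSymm →
      (M1, M2, M3) ≠ (Vᵀ * Aᵀ * A * V, Bᵀ * B, Bᵀ * A * V) →
      0 < ∑ k ∈ Finset.range K,
        (wbar k ⬝ᵥ M1.mulVec (wbar k) + g (k + 1) ⬝ᵥ M2.mulVec (g (k + 1))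
          + 2 * (g (k + 1) ⬝ᵥ M3.mulVec (wbar k)) - f (k + 1)) ^ 2 := by
  have hfit : ∀ k < K, wbar k ⬝ᵥ (Vᵀ * Aᵀ * A * V).mulVec (wbar k)
      + g (k + 1) ⬝ᵥ (Bᵀ * B).mulVec (g (k + 1))
      + 2 * (g (k + 1) ⬝ᵥ (Bᵀ * A * V).mulVec (wbar k)) = f (k + 1) := fun k hk => by
    rw [hf k hk, residual_quadratic_form_eq]
  refine ⟨Finset.sum_eq_zero fun k hk => by simp [hfit k (Finset.mem_range.1 hk)], ?_⟩
  intro M1 M2 M3 h1 h2 hne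
  refine (Finset.sum_nonneg fun k _ => sq_nonneg _).lt_of_ne' fun hzero => hne ?_
  rw [Finset.sum_eq_zero_iff_of_nonneg fun k _ => sq_nonneg _] at hzero
  have hsymm1 : (Vᵀ * Aᵀ * A * V).IsSymm := by
    simp [Matrix.IsSymm, transpose_mul, Matrix.mul_assoc]
  have hsymm2 : (Bᵀ * B).IsSymm := by simp [Matrix.IsSymm, transpose_mul]
  obtain ⟨e1, e2, e3⟩ := hinj (M1 - Vᵀ * Aᵀ * A * V) (M2 - Bᵀ * B) (M3 - Bᵀ * A * V)
    (h1.sub hsymm1) (h2.sub hsymm2) fun k hk => by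
      have hk0 := pow_eq_zero_iff two_ne_zero |>.1 (hzero k (Finset.mem_range.2 hk))
      have hk1 := hfit k hk
      simp only [sub_mulVec, dotProduct_sub]
      linarith
  rw [sub_eq_zero.1 e1, sub_eq_zero.1 e2, sub_eq_zero.1 e3]
end

section
/- Let A ∈ ℝ^{N×N} with ‖A‖₂ ≤ 1, B ∈ ℝ^{N×p}, V ∈ ℝ^{N×n}. Let (g_k)_{k≥1} be a sequence in ℝ^p, let (w_k)_{k≥0} in ℝ^N satisfy w_{k+1} = A w_k + B g_{k+1}, let (w̃_k)_{k≥0} in ℝ^n satisfy the reduced recursion w̃_{k+1} = Ã w̃_k + B̃ g_{k+1} with Ã = VᵀAV, B̃ = VᵀB, and define the residuals r_{k+1} = A V w̃_k + B g_{k+1} − V w̃_{k+1}. Then for every k ≥ 0, ‖w_k − V w̃_k‖₂ ≤ ‖w₀ − V w̃₀‖₂ + Σ_{l=0}^{k−1} ‖r_{l+1}‖₂. -/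
open Matrix

/-- Operator 2-norm (largest singular value) of a square real matrix. -/
noncomputable def op2norm {N : ℕ} (A : Matrix (Fin N) (Fin N) ℝ) : ℝ :=
  ‖Matrix.toEuclideanCLM (𝕜 := ℝ) (n := Fin N) A‖

theorem e2norm_add_le {N : ℕ} (u v : Fin N → ℝ) : e2norm (u + v) ≤ e2norm u + e2norm v :=
  norm_add_le (WithLp.toLp 2 u) (WithLp.toLp 2 v)

theorem e2norm_mulVec_le {N : ℕ} (A : Matrix (Fin N) (Fin N) ℝ) (v : Fin N → ℝ) :
    e2norm (A.mulVec v) ≤ op2norm A * e2norm v :=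
  (Matrix.toEuclideanCLM (𝕜 := ℝ) (n := Fin N) A).le_opNorm (WithLp.toLp 2 v)

/-- If `‖A‖₂ ≤ 1` and the reduced trajectory follows the Galerkin reduced model
`w̃_{k+1} = (VᵀAV) w̃_k + (VᵀB) g_{k+1}`, then the state error is bounded by
`‖w₀ − V w̃₀‖₂ + Σ_{l=0}^{k−1} ‖r_{l+1}‖₂`. -/
theorem state_error_bound_unit_opnorm
    (N n p : ℕ)
    (A : Matrix (Fin N) (Fin N) ℝ) (hA : op2norm A ≤ 1)
    (B : Matrix (Fin N) (Fin p) ℝ) (V : Matrix (Fin N) (Fin n) ℝ)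
    (g : ℕ → Fin p → ℝ) (w : ℕ → Fin N → ℝ) (wt : ℕ → Fin n → ℝ) (r : ℕ → Fin N → ℝ)
    (hw : ∀ k, w (k + 1) = A.mulVec (w k) + B.mulVec (g (k + 1)))
    (hwt : ∀ k, wt (k + 1) =
      (Vᵀ * A * V).mulVec (wt k) + (Vᵀ * B).mulVec (g (k + 1)))
    (hr : ∀ k, r (k + 1) =
      A.mulVec (V.mulVec (wt k)) + B.mulVec (g (k + 1)) - V.mulVec (wt (k + 1))) :
    ∀ k, e2norm (w k - V.mulVec (wt k)) ≤
      e2norm (w 0 - V.mulVec (wt 0))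
      + ∑ l ∈ Finset.range k, e2norm (r (l + 1)) := by
  intro k
  induction k with
  | zero => simp
  | succ k ih =>
    have herr : w (k + 1) - V.mulVec (wt (k + 1)) =
        A.mulVec (w k - V.mulVec (wt k)) + r (k + 1) := by
      rw [hr, hw, Matrix.mulVec_sub]
      abel
    have hcontr : e2norm (A.mulVec (w k - V.mulVec (wt k))) ≤ e2norm (w k - V.mulVec (wt k)) :=
      (e2norm_mulVec_le A _).trans (mul_le_of_le_one_left (norm_nonneg _) hA)
    rw [Finset.sum_range_succ, herr]
    linarith [e2norm_add_le (A.mulVec (w k - V.mulVec (wt k))) (r (k + 1))]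
end

section
/- Let A ∈ ℝ^{N×N}, B ∈ ℝ^{N×p}, V ∈ ℝ^{N×n}, and let C ∈ ℝ be such that ‖A^l‖₂ ≤ C for all 0 ≤ l ≤ k. Let (g_j)_{j≥1} be a sequence in ℝ^p, let (w_j)_{j≥0} in ℝ^N satisfy w_{j+1} = A w_j + B g_{j+1}, let (w̃_j)_{j≥0} be any sequence in ℝ^n, and define the residuals r_{j+1} = A V w̃_j + B g_{j+1} − V w̃_{j+1}. Then ‖w_k − V w̃_k‖₂ ≤ C ( ‖w₀ − V w̃₀‖₂ + Σ_{l=0}^{k−1} ‖r_{l+1}‖₂ ). -/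
open Matrix

theorem e2norm_nonneg {N : ℕ} (v : Fin N → ℝ) : 0 ≤ e2norm v :=
  norm_nonneg _

/-- Propagating the perturbed recursion `e (j + 1) = A e j + r (j + 1)` through a further power
of `A`. -/
theorem e2norm_pow_mulVec_le_of_recursion {N k : ℕ} {A : Matrix (Fin N) (Fin N) ℝ} {C : ℝ}
    (hC : ∀ l ≤ k, op2norm (A ^ l) ≤ C) {e r : ℕ → Fin N → ℝ}
    (he : ∀ j, e (j + 1) = A.mulVec (e j) + r (j + 1)) (j m : ℕ) (h : m + j ≤ k) :
    e2norm ((A ^ m).mulVec (e j)) ≤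
      C * (e2norm (e 0) + ∑ l ∈ Finset.range j, e2norm (r (l + 1))) := by
  have hpow : ∀ l ≤ k, ∀ v, e2norm ((A ^ l).mulVec v) ≤ C * e2norm v := fun l hl v =>
    (e2norm_mulVec_le _ v).trans (mul_le_mul_of_nonneg_right (hC l hl) (e2norm_nonneg v))
  induction j generalizing m with
  | zero => simpa using hpow m h (e 0)
  | succ j ih =>
    rw [he, Matrix.mulVec_add, Matrix.mulVec_mulVec, ← pow_succ, Finset.sum_range_succ,
      ← add_assoc, mul_add]
    exact (e2norm_add_le _ _).trans
      (add_le_add (ih (m + 1) (by omega)) (hpow m (by omega) _))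

/-- If `‖A^l‖₂ ≤ C` for all `0 ≤ l ≤ k`, then the state error at step `k` is bounded by
`C (‖w₀ − V w̃₀‖₂ + Σ_{l=0}^{k−1} ‖r_{l+1}‖₂)`. -/
theorem state_error_bound_constant
    (N n p k : ℕ)
    (A : Matrix (Fin N) (Fin N) ℝ) (B : Matrix (Fin N) (Fin p) ℝ)
    (V : Matrix (Fin N) (Fin n) ℝ)
    (C : ℝ) (hC : ∀ l ≤ k, op2norm (A ^ l) ≤ C)
    (g : ℕ → Fin p → ℝ) (w : ℕ → Fin N → ℝ) (wt : ℕ → Fin n → ℝ) (r : ℕ → Fin N → ℝ)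
    (hw : ∀ j, w (j + 1) = A.mulVec (w j) + B.mulVec (g (j + 1)))
    (hr : ∀ j, r (j + 1) =
      A.mulVec (V.mulVec (wt j)) + B.mulVec (g (j + 1)) - V.mulVec (wt (j + 1))) :
    e2norm (w k - V.mulVec (wt k)) ≤
      C * (e2norm (w 0 - V.mulVec (wt 0))
        + ∑ l ∈ Finset.range k, e2norm (r (l + 1))) := by
  have he : ∀ j, w (j + 1) - V.mulVec (wt (j + 1)) =
      A.mulVec (w j - V.mulVec (wt j)) + r (j + 1) := fun j => by
    rw [hw, hr, Matrix.mulVec_sub]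
    abel
  simpa using e2norm_pow_mulVec_le_of_recursion hC (e := fun j => w j - V.mulVec (wt j)) he k 0
    (by omega)
end

section
/- Let μ_N denote the standard Gaussian measure on ℝ^N and ν the standard normal distribution on ℝ. Then for every matrix A ∈ ℝ^{N×N} with A ≠ 0, every l ∈ ℕ, and every c > 0, μ_N { z ∈ ℝ^N : ‖A^l z‖₂² ≥ c ‖A^l‖₂² } ≥ ν { w ∈ ℝ : w² ≥ c }. -/
open Matrix MeasureTheory ProbabilityTheory

/-- A continuous linear map on a finite-dimensional normed space attains its operator norm on the
closed unit ball. -/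
lemma ContinuousLinearMap.exists_norm_le_one_opNorm_le {E F : Type*}
    [NormedAddCommGroup E] [NormedSpace ℝ E] [FiniteDimensional ℝ E]
    [NormedAddCommGroup F] [NormedSpace ℝ F] (S : E →L[ℝ] F) :
    ∃ y : E, ‖y‖ ≤ 1 ∧ ‖S‖ ≤ ‖S y‖ := by
  have := FiniteDimensional.proper_real E
  obtain ⟨y, hy, hmax⟩ := (isCompact_closedBall (0 : E) 1).exists_isMaxOn
    ⟨0, by simp⟩ S.continuous.norm.continuousOn
  refine ⟨y, by simpa using hy, S.opNorm_le_of_unit_norm (norm_nonneg _) fun x hx => ?_⟩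
  exact hmax (by simp [hx])

/-- A linear functional on a standard Gaussian vector is distributed as its norm times a standard
normal variable. -/
lemma ProbabilityTheory.stdGaussian_map_strongDual {E : Type*} [NormedAddCommGroup E]
    [InnerProductSpace ℝ E] [FiniteDimensional ℝ E] [MeasurableSpace E] [BorelSpace E]
    (L : StrongDual ℝ E) :
    (stdGaussian E).map L = (gaussianReal 0 1).map (‖L‖ * ·) := by
  rw [IsGaussian.map_eq_gaussianReal, integral_strongDual_stdGaussian, variance_dual_stdGaussian,
    gaussianReal_map_const_mul, mul_zero, mul_one]
  congr 1
  exact NNReal.eq (Real.coe_toNNReal _ (sq_nonneg _))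

/-- The image of a standard Gaussian vector under `T` has squared norm at least `c * ‖T‖ ^ 2` with
probability at least that of a squared standard normal variable being at least `c`. -/
lemma ProbabilityTheory.gaussianReal_le_stdGaussian_opNorm {E F : Type*}
    [NormedAddCommGroup E] [InnerProductSpace ℝ E] [FiniteDimensional ℝ E]
    [MeasurableSpace E] [BorelSpace E]
    [NormedAddCommGroup F] [InnerProductSpace ℝ F] [FiniteDimensional ℝ F]
    (T : E →L[ℝ] F) {c : ℝ} (hc : 0 ≤ c) :
    gaussianReal 0 1 {w : ℝ | c ≤ w ^ 2} ≤
      stdGaussian E {z : E | c * ‖T‖ ^ 2 ≤ ‖T z‖ ^ 2} := by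
  have := FiniteDimensional.complete ℝ E
  have := FiniteDimensional.complete ℝ F
  obtain ⟨y, hy, hTy⟩ := (ContinuousLinearMap.adjoint T).exists_norm_le_one_opNorm_le
  rw [LinearIsometryEquiv.norm_map] at hTy
  set L : StrongDual ℝ E := innerSL ℝ (ContinuousLinearMap.adjoint T y) with hL
  have hLnorm : ‖L‖ = ‖ContinuousLinearMap.adjoint T y‖ := innerSL_apply_norm ℝ _
  have hLle (z : E) : |L z| ≤ ‖T z‖ := by
    rw [hL, innerSL_apply_apply, ContinuousLinearMap.adjoint_inner_left]
    calc |inner ℝ y (T z)| ≤ ‖y‖ * ‖T z‖ := abs_real_inner_le_norm _ _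
      _ ≤ ‖T z‖ := mul_le_of_le_one_left (norm_nonneg _) hy
  have hmeas : MeasurableSet {t : ℝ | c * ‖L‖ ^ 2 ≤ t ^ 2} :=
    measurableSet_le measurable_const (by fun_prop)
  calc gaussianReal 0 1 {w : ℝ | c ≤ w ^ 2}
      ≤ gaussianReal 0 1 ((‖L‖ * ·) ⁻¹' {t : ℝ | c * ‖L‖ ^ 2 ≤ t ^ 2}) := by
        refine measure_mono fun w (hw : c ≤ w ^ 2) => ?_
        simp only [Set.mem_preimage, Set.mem_ofPred_eq, mul_pow, mul_comm c]
        gcongr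
    _ = stdGaussian E (L ⁻¹' {t : ℝ | c * ‖L‖ ^ 2 ≤ t ^ 2}) := by
        rw [← Measure.map_apply (by fun_prop) hmeas, ← stdGaussian_map_strongDual,
          Measure.map_apply (by fun_prop) hmeas]
    _ ≤ stdGaussian E {z : E | c * ‖T‖ ^ 2 ≤ ‖T z‖ ^ 2} := by
        refine measure_mono fun z hz => ?_
        simp only [Set.mem_preimage, Set.mem_ofPred_eq] at hz ⊢
        calc c * ‖T‖ ^ 2 ≤ c * ‖L‖ ^ 2 := by rw [hLnorm]; gcongr
          _ ≤ L z ^ 2 := hz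
          _ ≤ ‖T z‖ ^ 2 := sq_le_sq' (abs_le.mp (hLle z)).1 (abs_le.mp (hLle z)).2

/-- Under the standard Gaussian measure on `ℝ^N`, the probability that
`‖A^l z‖₂² ≥ c ‖A^l‖₂²` is at least the probability that a standard normal `w`
satisfies `w² ≥ c`. -/
theorem gaussian_lower_bound_opnorm
    (N : ℕ) (A : Matrix (Fin N) (Fin N) ℝ) (hA : A ≠ 0) (l : ℕ) (c : ℝ) (hc : 0 < c) :
    (gaussianReal 0 1) {w : ℝ | c ≤ w ^ 2} ≤
      (Measure.pi fun _ : Fin N => gaussianReal 0 1)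
        {z : Fin N → ℝ | c * (op2norm (A ^ l)) ^ 2 ≤ (e2norm ((A ^ l).mulVec z)) ^ 2} := by
  have h := gaussianReal_le_stdGaussian_opNorm
    (toEuclideanCLM (𝕜 := ℝ) (n := Fin N) (A ^ l)) hc.le
  rwa [← map_pi_eq_stdGaussian, Measure.map_apply (by fun_prop)
    (measurableSet_le measurable_const (by fun_prop))] at h
end
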